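/- arXiv:0811.1047 — 7 statements merged into one kernel-verified Lean document; each statement's English description precedes it below -/
import Mathlib

section
/- Let n be a natural number and let P be a nonzero polynomial in two variables with real coefficients of total degree at most n. Let a be a positive integer, let ε be a positive real number, and let r be a positive real number. Assume there exists N ∈ ℕ such that P(p,q) = 0 for all natural numbers p, q ≥ N satisfying 0 < a·q − r·p < ε. Then r is rational; moreover, writing r = u/v with u, v positive integers and gcd(u,v) = 1, one has v ≤ a(n+1)/ε. -/
open MvPolynomial

lemma line_zero (n : ℕ) (P : MvPolynomial (Fin 2) ℝ) (hdeg : P.totalDegree ≤ n)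
    (A0 A1 B0 B1 : ℝ) (S : Finset ℝ) (hS : n < S.card)
    (h : ∀ t ∈ S, MvPolynomial.eval ![A0 + t * B0, A1 + t * B1] P = 0) (t : ℝ) :
    MvPolynomial.eval ![A0 + t * B0, A1 + t * B1] P = 0 := by
  set f : Polynomial ℝ := MvPolynomial.aeval
    ![Polynomial.C A0 + Polynomial.X * Polynomial.C B0,
      Polynomial.C A1 + Polynomial.X * Polynomial.C B1] P with hf
  have hev : ∀ t, f.eval t = MvPolynomial.eval ![A0 + t * B0, A1 + t * B1] P := by
    intro t
    rw [hf, ← Polynomial.coe_evalRingHom, MvPolynomial.aeval_def, MvPolynomial.eval₂_eq',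
      MvPolynomial.eval_eq']
    simp [Fin.prod_univ_two]
    simp only [mul_comm t]
  have hd : f.natDegree ≤ n := by
    refine (MvPolynomial.aeval_natDegree_le P hdeg _ (n := 1) ?_).trans (by simp)
    intro i
    fin_cases i <;> simp <;> compute_degree
  have : f = 0 := Polynomial.eq_zero_of_natDegree_lt_card_of_eval_eq_zero' f S
    (fun t ht => by rw [hev]; exact h t ht) (by omega)
  rw [← hev, this]; simp

lemma vert_zero (n : ℕ) (P : MvPolynomial (Fin 2) ℝ) (hdeg : P.totalDegree ≤ n)
    (h : ∀ x : ℝ, x ≠ 0 → ∃ S : Finset ℝ, n < S.card ∧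
      ∀ y ∈ S, MvPolynomial.eval ![x, y] P = 0) : P = 0 := by
  have h1 : ∀ x y : ℝ, x ≠ 0 → MvPolynomial.eval ![x, y] P = 0 := by
    intro x y hx
    obtain ⟨S, hS, hz⟩ := h x hx
    simpa using line_zero n P hdeg x 0 0 1 S hS (by simpa using hz) y
  have h2 : ∀ x y : ℝ, MvPolynomial.eval ![x, y] P = 0 := by
    intro x y
    let S : Finset ℝ := (Finset.range (n + 1)).image (fun i : ℕ => (i : ℝ) + 1)
    have hS : n < S.card := by
      rw [Finset.card_image_of_injective _ (fun i j hij => by simpa using hij)]; simp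
    have := line_zero n P hdeg 0 y 1 0 S hS (by
      intro t ht
      obtain ⟨i, -, rfl⟩ := Finset.mem_image.1 ht
      have := h1 ((i : ℝ) + 1) y (by positivity)
      simpa using this) x
    simpa using this
  apply MvPolynomial.funext
  intro x
  rw [show x = ![x 0, x 1] by ext i; fin_cases i <;> rfl, h2]; simp

lemma approx_one (ξ : ℝ) (hirr : Irrational ξ) (hpos : 0 < ξ) (η : ℝ) (hη : 0 < η) :
    ∃ p q : ℕ, 0 < p ∧ 0 < (q : ℝ) - ξ * p ∧ (q : ℝ) - ξ * p < η := by
  suffices ∃ p q : ℤ, 0 < p ∧ 0 < (q : ℝ) - ξ * p ∧ (q : ℝ) - ξ * p < η by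
    obtain ⟨p, q, hp, h1, h2⟩ := this
    have hp' : (0 : ℝ) < p := by exact_mod_cast hp
    have hq : (0 : ℝ) < q := by nlinarith [mul_pos hpos hp']
    have hq : 0 < q := by exact_mod_cast hq
    lift p to ℕ using hp.le
    lift q to ℕ using hq.le
    exact ⟨p, q, by exact_mod_cast hp, by exact_mod_cast h1, by exact_mod_cast h2⟩
  obtain ⟨m, hm⟩ := exists_nat_gt (1 / (min η 1))
  have hmin : 0 < min η 1 := by positivity
  have hm0 : (0 : ℝ) < m := lt_trans (by positivity) hm
  have hmlt : 1 / ((m : ℝ) + 1) < min η 1 := by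
    rw [div_lt_iff₀ hmin] at hm
    rw [div_lt_iff₀ (by positivity)]
    nlinarith
  obtain ⟨j, k, hk, -, hjk⟩ := Real.exists_int_int_abs_mul_sub_le ξ (n := m) (by exact_mod_cast hm0)
  have hlt := lt_of_le_of_lt hjk hmlt
  obtain ⟨hl1, hl2⟩ := abs_lt.1 hlt
  have hη1 := min_le_left η 1
  have hη2 := min_le_right η 1
  have hne : (k : ℝ) * ξ - j ≠ 0 := by
    have := ((hirr.intCast_mul hk.ne').sub_intCast j).ne_zero
    exact this
  rcases lt_or_gt_of_ne hne with hneg | hpos'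
  · exact ⟨k, j, hk, by linarith, by linarith⟩
  · set e := (k : ℝ) * ξ - j with he
    have he1 : 1 < 1 / e := by rw [lt_div_iff₀ hpos']; linarith
    have hc1 : (1 : ℝ) / e ≤ ⌈1 / e⌉ := Int.le_ceil _
    have hc2 : (⌈1 / e⌉ : ℝ) < 1 / e + 1 := Int.ceil_lt_add_one _
    have hc : 1 < ⌈1 / e⌉ := by
      have : (1 : ℝ) < ⌈1 / e⌉ := by linarith
      exact_mod_cast this
    have hee : 1 / e * e = 1 := by field_simp
    have key : ((1 + (⌈1 / e⌉ - 1) * j : ℤ) : ℝ) - ξ * (((⌈1 / e⌉ - 1) * k : ℤ) : ℝ)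
        = 1 - (⌈1 / e⌉ - 1) * e := by
      push_cast; rw [he]; ring
    refine ⟨(⌈1 / e⌉ - 1) * k, 1 + (⌈1 / e⌉ - 1) * j, mul_pos (by omega) hk, ?_, ?_⟩
    · rw [key]; nlinarith
    · rw [key]; nlinarith

lemma approx_large (a : ℕ) (ha : 0 < a) (r : ℝ) (hirr : Irrational r) (hr : 0 < r) (N : ℕ)
    (δ : ℝ) (hδ : 0 < δ) :
    ∃ p q : ℕ, 0 < p ∧ N ≤ p ∧ N ≤ q ∧ 0 < (a : ℝ) * q - r * p ∧ (a : ℝ) * q - r * p < δ := by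
  have ha' : (0 : ℝ) < a := by exact_mod_cast ha
  obtain ⟨p, q, hp, h1, h2⟩ := approx_one (r / a) (hirr.div_natCast ha.ne') (by positivity)
    (δ / (a * (N + 1))) (by positivity)
  have hp' : (0 : ℝ) < p := by exact_mod_cast hp
  have hq : 0 < q := by
    have : (0 : ℝ) < q := by nlinarith [mul_pos (div_pos hr ha') hp']
    exact_mod_cast this
  have key : (a : ℝ) * ((N + 1) * q : ℕ) - r * ((N + 1) * p : ℕ)
      = (q - r / a * p) * (a * (N + 1)) := by
    push_cast; field_simp
  refine ⟨(N + 1) * p, (N + 1) * q, by positivity, by nlinarith, by nlinarith, ?_, ?_⟩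
  · rw [key]; positivity
  · rw [key]; rwa [lt_div_iff₀ (by positivity)] at h2

lemma irr_case (n : ℕ) (P : MvPolynomial (Fin 2) ℝ)
    (hdeg : P.totalDegree ≤ n) (a : ℕ) (ha : 0 < a) (ε : ℝ) (hε : 0 < ε)
    (r : ℝ) (hr : 0 < r) (N : ℕ)
    (hvan : ∀ p q : ℕ, N ≤ p → N ≤ q →
      0 < (a : ℝ) * q - r * p → (a : ℝ) * q - r * p < ε →
      MvPolynomial.eval ![(p : ℝ), (q : ℝ)] P = 0) (hirr : Irrational r) : P = 0 := by
  have ha' : (0 : ℝ) < a := by exact_mod_cast ha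
  let T : Set ℝ := {m | r < a * m ∧ ∀ x : ℝ, MvPolynomial.eval ![x, m * x] P = 0}
  have hT : ∀ b : ℝ, r < a * b → ∃ m ∈ T, m < b := by
    intro b hb
    obtain ⟨p, q, hp, hpN, hqN, h1, h2⟩ := approx_large a ha r hirr hr N
      (min (ε / (n + 1)) (a * b - r)) (lt_min (by positivity) (by linarith))
    have h3 := h2.trans_le (min_le_left _ _)
    have h4 := h2.trans_le (min_le_right _ _)
    have hp1 : (1 : ℝ) ≤ p := by exact_mod_cast hp
    have hp' : (0 : ℝ) < p := by exact_mod_cast hp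
    refine ⟨q / p, ⟨?_, ?_⟩, ?_⟩
    · rw [← mul_div_assoc, lt_div_iff₀ hp']; linarith
    · intro x
      let S : Finset ℝ := (Finset.range (n + 1)).image (fun i : ℕ => (i : ℝ) + 1)
      have hS : n < S.card := by
        rw [Finset.card_image_of_injective _ (fun i j hij => by simpa using hij)]; simp
      have := line_zero n P hdeg 0 0 p q S hS (by
        intro t ht
        obtain ⟨i, hi, rfl⟩ := Finset.mem_image.1 ht
        have hi' : (i : ℝ) + 1 ≤ n + 1 := by
          have := Finset.mem_range.1 hi
          exact_mod_cast this
        have key : (a : ℝ) * ((i + 1) * q : ℕ) - r * ((i + 1) * p : ℕ)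
            = (a * q - r * p) * (i + 1) := by push_cast; ring
        have := hvan ((i + 1) * p) ((i + 1) * q) (by nlinarith) (by nlinarith)
          (by rw [key]; positivity)
          (by
            rw [key]
            rw [lt_div_iff₀ (by positivity)] at h3
            nlinarith)
        simpa using this) (x / p)
      have e1 : x / p * p = x := by field_simp
      have e2 : x / p * q = q / p * x := by field_simp
      rw [e1, e2] at this
      simpa using this
    · rw [div_lt_iff₀ hp']
      have : (a : ℝ) * q < a * (b * p) := by nlinarith
      exact lt_of_mul_lt_mul_left this ha'.le
  have hinf : T.Infinite := by
    intro hfin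
    obtain ⟨m0, hm0, -⟩ := hT (r / a + 1) (by field_simp; linarith)
    obtain ⟨m, hm, hmin⟩ := Set.exists_min_image T id hfin ⟨m0, hm0⟩
    obtain ⟨m', hm', hlt⟩ := hT m hm.1
    exact absurd (hmin m' hm') (not_le.2 hlt)
  apply vert_zero n P hdeg
  intro x hx
  obtain ⟨S, hST, hS⟩ := hinf.exists_subset_card_eq (n + 1)
  refine ⟨S.image (fun m => m * x), ?_, ?_⟩
  · rw [Finset.card_image_of_injective _ (mul_left_injective₀ hx), hS]; simp
  · intro y hy
    obtain ⟨m, hm, rfl⟩ := Finset.mem_image.1 hy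
    exact (hST hm).2 x

lemma rat_case (n : ℕ) (P : MvPolynomial (Fin 2) ℝ)
    (hdeg : P.totalDegree ≤ n) (a : ℕ) (ha : 0 < a) (ε : ℝ)
    (u v : ℕ) (hu : 0 < u) (hv : 0 < v) (huv : Nat.gcd u v = 1) (N : ℕ)
    (hvan : ∀ p q : ℕ, N ≤ p → N ≤ q →
      0 < (a : ℝ) * q - (u / v : ℝ) * p → (a : ℝ) * q - (u / v : ℝ) * p < ε →
      MvPolynomial.eval ![(p : ℝ), (q : ℝ)] P = 0) (hlt : (a : ℝ) * (n + 1) < ε * v) : P = 0 := by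
  have ha' : (0 : ℝ) < a := by exact_mod_cast ha
  have hv' : (0 : ℝ) < v := by exact_mod_cast hv
  have hline : ∀ k : ℕ, 0 < k → k ≤ n + 1 → ∀ x : ℝ,
      MvPolynomial.eval ![x, (k + u * x / a) / v] P = 0 := by
    intro k hk hkn x
    have hk' : (0 : ℝ) < k := by exact_mod_cast hk
    have hkn' : (k : ℝ) ≤ n + 1 := by exact_mod_cast hkn
    obtain ⟨p0, q0, hpq⟩ : ∃ p0 q0 : ℤ, v * q0 - u * p0 = k := by
      have := Nat.gcd_eq_gcd_ab u v
      rw [huv] at this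
      push_cast at this
      exact ⟨-(k * Nat.gcdA u v), k * Nat.gcdB u v, by linear_combination -(k : ℤ) * this⟩
    have hpqR : (v : ℝ) * q0 - u * p0 = k := by exact_mod_cast hpq
    let t0 : ℕ := N + p0.natAbs + q0.natAbs
    let S : Finset ℝ := (Finset.range (n + 1)).image (fun i : ℕ => (i : ℝ) + t0)
    have hS : n < S.card := by
      rw [Finset.card_image_of_injective _ (fun i j hij => by simpa using hij)]; simp
    have := line_zero n P hdeg (a * p0) q0 (a * v) u S hS (by
      intro t ht
      obtain ⟨i, hi, rfl⟩ := Finset.mem_image.1 ht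
      have hb1 : (N : ℤ) ≤ p0 + v * (i + t0) := by
        have : (1 : ℤ) * (i + t0) ≤ v * (i + t0) := by gcongr; omega
        omega
      have hb2 : (N : ℤ) ≤ q0 + u * (i + t0) := by
        have : (1 : ℤ) * (i + t0) ≤ u * (i + t0) := by gcongr; omega
        omega
      obtain ⟨p, hp⟩ := Int.eq_ofNat_of_zero_le (le_trans (by positivity) hb1)
      obtain ⟨q, hq⟩ := Int.eq_ofNat_of_zero_le (le_trans (by positivity) hb2)
      have hpR : (p0 : ℝ) + v * (i + t0) = p := by exact_mod_cast hp
      have hqR : (q0 : ℝ) + u * (i + t0) = q := by exact_mod_cast hq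
      have key : (a : ℝ) * q - (u / v : ℝ) * (a * p : ℕ) = a * k / v := by
        rw [← hpqR]; push_cast; rw [← hpR, ← hqR]; field_simp; ring
      have hpN : N ≤ p := by omega
      have := hvan (a * p) q (by nlinarith) (by omega) (by rw [key]; positivity)
        (by rw [key, div_lt_iff₀ hv']; nlinarith)
      rw [← hqR] at this
      push_cast at this
      rw [← hpR] at this
      have e1 : (a : ℝ) * p0 + (i + t0) * (a * v) = a * (p0 + v * (i + t0)) := by ring
      have e2 : (q0 : ℝ) + (i + t0) * u = q0 + u * (i + t0) := by ring
      rw [e1, e2]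
      exact this) ((x - a * p0) / (a * v))
    have e1 : (a : ℝ) * p0 + (x - a * p0) / (a * v) * (a * v) = x := by field_simp; ring
    have e2 : (q0 : ℝ) + (x - a * p0) / (a * v) * u = (k + u * x / a) / v := by
      rw [← hpqR]; field_simp; ring
    rw [e1, e2] at this
    exact this
  apply vert_zero n P hdeg
  intro x hx
  refine ⟨(Finset.range (n + 1)).image (fun i : ℕ => (((i + 1 : ℕ) : ℝ) + u * x / a) / v), ?_, ?_⟩
  · rw [Finset.card_image_of_injective]
    · simp
    · intro i j hij
      have : (((i + 1 : ℕ) : ℝ) + u * x / a) / v = (((j + 1 : ℕ) : ℝ) + u * x / a) / v := hij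
      rw [div_left_inj' hv'.ne'] at this
      simpa using this
  · intro y hy
    obtain ⟨i, hi, rfl⟩ := Finset.mem_image.1 hy
    exact hline (i + 1) (by omega) (by have := Finset.mem_range.1 hi; omega) x

/-- Arithmetic lemma (Lemma 3.8, Kollár–Mori) used in the Rationality theorem. -/
theorem stmt_0 (n : ℕ) (P : MvPolynomial (Fin 2) ℝ) (hP : P ≠ 0)
    (hdeg : P.totalDegree ≤ n) (a : ℕ) (ha : 0 < a) (ε : ℝ) (hε : 0 < ε)
    (r : ℝ) (hr : 0 < r)
    (hvan : ∃ N : ℕ, ∀ p q : ℕ, N ≤ p → N ≤ q →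
      0 < (a : ℝ) * q - r * p → (a : ℝ) * q - r * p < ε →
      MvPolynomial.eval ![(p : ℝ), (q : ℝ)] P = 0) :
    ∃ u v : ℕ, 0 < u ∧ 0 < v ∧ Nat.gcd u v = 1 ∧ r = (u : ℝ) / v ∧
      (v : ℝ) ≤ a * (n + 1) / ε := by
  obtain ⟨N, hN⟩ := hvan
  by_cases hirr : Irrational r
  · exact absurd (irr_case n P hdeg a ha ε hε r hr N hN hirr) hP
  · rw [Irrational, not_not] at hirr
    obtain ⟨x, rfl⟩ := hirr
    have hx : 0 < x := by exact_mod_cast hr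
    have hnum : 0 < x.num := Rat.num_pos.2 hx
    have heq : (x : ℝ) = (x.num.natAbs : ℝ) / x.den := by
      rw [Nat.cast_natAbs, abs_of_pos hnum]
      exact_mod_cast (Rat.num_div_den x).symm
    refine ⟨x.num.natAbs, x.den, by omega, x.den_pos, x.reduced, heq, ?_⟩
    by_contra hcon
    rw [not_le, div_lt_iff₀ hε] at hcon
    rw [heq] at hN
    exact hP (rat_case n P hdeg a ha ε _ _ (by omega) x.den_pos x.reduced N hN (by linarith))
end

section
/- Let l and N be positive integers and let p₁, …, p_l ∈ ℕ^N be vectors that are linearly independent over ℝ. Let d = Σ_{k=1}^{l} t_k p_k with t₁, …, t_l nonnegative real numbers, and assume that d ∉ ℚ^N (i.e. some coordinate of d is irrational). Then for every ε > 0 there exist a positive integer j and natural numbers m₁, …, m_l such that, setting w = j·d − Σ_{k=1}^{l} m_k p_k ∈ ℝ^N, one has ‖w‖_∞ < ε and w has at least one strictly negative coordinate (in particular w is not componentwise ≥ 0). -/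
open Finset

lemma recur_aux (l : ℕ) (t : Fin l → ℝ) (δ : ℝ) (hδ : 0 < δ) (M : ℕ) :
    ∃ (q : ℕ) (a : Fin l → ℤ), M < q ∧ ∀ k, |(q : ℝ) * t k - a k| < δ := by
  have hc : IsCompact (Set.Icc (0 : Fin l → ℝ) 1) := isCompact_Icc
  have hx : ∀ n : ℕ, (fun k => Int.fract ((n : ℝ) * t k)) ∈ Set.Icc (0 : Fin l → ℝ) 1 := by
    intro n
    exact ⟨fun k => Int.fract_nonneg _, fun k => (Int.fract_lt_one _).le⟩
  obtain ⟨x, -, φ, hφ, hlim⟩ := hc.tendsto_subseq hx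
  obtain ⟨K, hK⟩ := Metric.cauchySeq_iff.1 hlim.cauchySeq δ hδ
  have h1 := hK (K + φ K + M + 1) (by omega) K le_rfl
  have h2 : φ K + M + 1 ≤ φ (K + φ K + M + 1) := le_trans (by omega : φ K + M + 1 ≤ K + φ K + M + 1) (hφ.id_le _)
  simp only [Function.comp] at h1
  generalize hb : φ (K + φ K + M + 1) = b at h1 h2
  generalize hcc : φ K = c at h1 h2
  refine ⟨b - c, fun k => ⌊(b : ℝ) * t k⌋ - ⌊(c : ℝ) * t k⌋, by omega, fun k => ?_⟩
  have h3 := lt_of_le_of_lt (dist_le_pi_dist _ _ k) h1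
  rw [Real.dist_eq] at h3
  rw [Nat.cast_sub (by omega)]
  have h4 : ((b : ℝ) - c) * t k - ((⌊(b : ℝ) * t k⌋ - ⌊(c : ℝ) * t k⌋ : ℤ) : ℝ)
      = Int.fract ((b : ℝ) * t k) - Int.fract ((c : ℝ) * t k) := by
    unfold Int.fract
    push_cast
    ring
  rw [h4]
  exact h3

/-- Combinatorial content of the Approximation Lemma. -/
theorem stmt_2 (l N : ℕ) (hl : 0 < l) (hN : 0 < N)
    (p : Fin l → Fin N → ℕ)
    (hind : LinearIndependent ℝ (fun k : Fin l => fun i : Fin N => (p k i : ℝ)))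
    (t : Fin l → ℝ) (ht : ∀ k, 0 ≤ t k)
    (d : Fin N → ℝ) (hd : d = fun i => ∑ k, t k * (p k i : ℝ))
    (hirr : ∃ i, Irrational (d i))
    (ε : ℝ) (hε : 0 < ε) :
    ∃ (j : ℕ) (m : Fin l → ℕ), 0 < j ∧
      (∀ i, |(j : ℝ) * d i - ∑ k, (m k : ℝ) * (p k i : ℝ)| < ε) ∧
      (∃ i, (j : ℝ) * d i - ∑ k, (m k : ℝ) * (p k i : ℝ) < 0) := by
  have hsum : ∀ (q : ℝ) (a : Fin l → ℝ) (i : Fin N),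
      q * d i - ∑ k, a k * (p k i : ℝ) = ∑ k, (q * t k - a k) * (p k i : ℝ) := by
    intro q a i
    rw [hd, Finset.mul_sum, ← Finset.sum_sub_distrib]
    exact Finset.sum_congr rfl fun k _ => by ring
  simp only [hsum]
  -- reduction to integer coefficients
  have key : ∀ (j : ℕ) (a : Fin l → ℤ), 0 < j → (∀ k, |(j : ℝ) * t k - a k| < 1) →
      (∀ i, |∑ k, ((j : ℝ) * t k - a k) * (p k i : ℝ)| < ε) →
      (∃ i, ∑ k, ((j : ℝ) * t k - a k) * (p k i : ℝ) < 0) →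
      ∃ (j : ℕ) (m : Fin l → ℕ), 0 < j ∧
      (∀ i, |∑ k, ((j : ℝ) * t k - m k) * (p k i : ℝ)| < ε) ∧
      (∃ i, ∑ k, ((j : ℝ) * t k - m k) * (p k i : ℝ) < 0) := by
    intro j a hj h1 h2 h3
    have ha : ∀ k, 0 ≤ a k := by
      intro k
      have h := (abs_lt.1 (h1 k)).2
      have h' : 0 ≤ (j : ℝ) * t k := mul_nonneg (Nat.cast_nonneg _) (ht k)
      have : (-1 : ℝ) < a k := by linarith
      have : (-1 : ℤ) < a k := by exact_mod_cast this
      omega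
    have hcast : ∀ k, (((a k).toNat : ℕ) : ℝ) = (a k : ℝ) := by
      intro k
      exact_mod_cast Int.toNat_of_nonneg (ha k)
    refine ⟨j, fun k => (a k).toNat, hj, ?_, ?_⟩
    · simpa only [hcast] using h2
    · simpa only [hcast] using h3
  -- size bound
  obtain ⟨C, hC, hbd⟩ : ∃ C : ℝ, 0 < C ∧ ∀ (δ : ℝ) (e : Fin l → ℝ), 0 < δ → (∀ k, |e k| < δ) →
      ∀ i, |∑ k, e k * (p k i : ℝ)| < δ * C := by
    refine ⟨1 + ∑ i, ∑ k, (p k i : ℝ), by positivity, fun δ e hδ he i => ?_⟩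
    have h1 : |∑ k, e k * (p k i : ℝ)| ≤ ∑ k, δ * (p k i : ℝ) := by
      refine (Finset.abs_sum_le_sum_abs _ _).trans (Finset.sum_le_sum fun k _ => ?_)
      rw [abs_mul, Nat.abs_cast]
      exact mul_le_mul_of_nonneg_right (he k).le (Nat.cast_nonneg _)
    have h2 : ∑ k, (p k i : ℝ) ≤ ∑ i, ∑ k, (p k i : ℝ) :=
      Finset.single_le_sum (f := fun i => ∑ k, (p k i : ℝ)) (fun i _ => by positivity)
        (Finset.mem_univ i)
    rw [← Finset.mul_sum] at h1
    nlinarith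
  set δ : ℝ := min (1 / 2) (ε / (2 * C)) with hδdef
  have hδ : 0 < δ := by positivity
  have hδ1 : δ ≤ 1 / 2 := min_le_left _ _
  have hδ2 : δ * C ≤ ε / 2 := by
    have : δ ≤ ε / (2 * C) := min_le_right _ _
    calc δ * C ≤ ε / (2 * C) * C := mul_le_mul_of_nonneg_right this hC.le
      _ = ε / 2 := by field_simp
  obtain ⟨q, a, hq, hqa⟩ := recur_aux l t δ hδ 0
  have hw := hbd δ _ hδ hqa
  by_cases hneg : ∃ i, ∑ k, ((q : ℝ) * t k - a k) * (p k i : ℝ) < 0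
  · exact key q a hq (fun k => by linarith [hqa k]) (fun i => by linarith [hw i]) hneg
  push Not at hneg
  obtain ⟨i, hi⟩ : ∃ i, 0 < ∑ k, ((q : ℝ) * t k - a k) * (p k i : ℝ) := by
    by_contra hcon
    push Not at hcon
    have hz : ∑ k, ((q : ℝ) * t k - a k) • (fun i : Fin N => (p k i : ℝ)) = 0 := by
      funext i
      simpa [Finset.sum_apply] using le_antisymm (hcon i) (hneg i)
    have he := Fintype.linearIndependent_iff.1 hind _ hz
    obtain ⟨i, hi⟩ := hirr
    apply hi
    have hq' : (q : ℝ) ≠ 0 := by positivity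
    refine ⟨∑ k, ((a k : ℚ) / q) * (p k i : ℚ), ?_⟩
    rw [hd]
    push_cast
    refine Finset.sum_congr rfl fun k _ => ?_
    have : t k = a k / q := by
      rw [eq_div_iff hq']
      linarith [he k]
    rw [this]
  set s := ∑ k, ((q : ℝ) * t k - a k) * (p k i : ℝ) with hs
  obtain ⟨q', a', hq', hqa'⟩ := recur_aux l t (min δ (s / C)) (by positivity) q
  have hd' : ∀ k, ((q' - q : ℕ) : ℝ) * t k - ((a' k - a k : ℤ) : ℝ)
      = ((q' : ℝ) * t k - a' k) - ((q : ℝ) * t k - a k) := by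
    intro k
    rw [Nat.cast_sub hq'.le]
    push_cast
    ring
  have hw1 := hbd δ _ hδ (fun k => (hqa' k).trans_le (min_le_left _ _))
  have hw2 := hbd (s / C) _ (by positivity) (fun k => (hqa' k).trans_le (min_le_right _ _)) i
  rw [div_mul_cancel₀ _ hC.ne'] at hw2
  refine key (q' - q) (fun k => a' k - a k) (by omega) (fun k => ?_) (fun i => ?_) ⟨i, ?_⟩
  · rw [hd']
    have h1 := abs_lt.1 (hqa k)
    have h2 := abs_lt.1 ((hqa' k).trans_le (min_le_left _ _))
    rw [abs_lt]
    constructor <;> linarith [h1.1, h1.2, h2.1, h2.2]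
  · simp only [hd', sub_mul _ _ (p _ i : ℝ), Finset.sum_sub_distrib]
    have h1 := abs_lt.1 (hw i)
    have h2 := abs_lt.1 (hw1 i)
    simp only [sub_mul _ _ (p _ i : ℝ), Finset.sum_sub_distrib] at h1 h2
    rw [abs_lt]
    constructor <;> linarith [h1.1, h1.2, h2.1, h2.2]
  · have : ∑ k, (((q' - q : ℕ) : ℝ) * t k - ((a' k - a k : ℤ) : ℝ)) * (p k i : ℝ)
        = ∑ k, ((q' : ℝ) * t k - a' k) * (p k i : ℝ) - s := by
      rw [hs, ← Finset.sum_sub_distrib]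
      exact Finset.sum_congr rfl fun k _ => by rw [hd']; ring
    rw [this]
    linarith [(abs_lt.1 hw2).2]
end

section
/- Let d be a real number and let b be a real number with 0 < b < 1. Suppose that the fractional part {j·d} = j·d − ⌊j·d⌋ satisfies {j·d} ≤ b for every positive integer j. Then d is rational; moreover, if v is the least positive integer such that v·d ∈ ℤ, then v ≤ 1/(1−b). -/
/-- If `0 < b < 1` and the fractional part of `j·d` is at most `b` for every
positive integer `j`, then `d` is rational and the least positive integer `v`
with `v·d ∈ ℤ` satisfies `v ≤ 1/(1-b)`. -/
theorem stmt_5 (d b : ℝ) (hb0 : 0 < b) (hb1 : b < 1)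
    (hfract : ∀ j : ℕ, 0 < j → Int.fract ((j : ℝ) * d) ≤ b) :
    (∃ c : ℚ, d = (c : ℝ)) ∧
    ∀ v : ℕ, (0 < v ∧ (∃ m : ℤ, (v : ℝ) * d = (m : ℝ)) ∧
        (∀ w : ℕ, 0 < w → (∃ m : ℤ, (w : ℝ) * d = (m : ℝ)) → v ≤ w)) →
      (v : ℝ) ≤ 1 / (1 - b) := by
  have key : ∀ (j : ℤ) (z : ℤ) (e : ℝ), 0 < j → (j : ℝ) * d = z + e → 0 ≤ e → e < 1 → e ≤ b := by
    intro j z e hj h h0 h1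
    have h2 := hfract j.toNat (by omega)
    have h3 : ((j.toNat : ℕ) : ℝ) = (j : ℝ) := by
      exact_mod_cast Int.toNat_of_nonneg hj.le
    rw [h3, h, Int.fract_intCast_add, Int.fract_eq_self.mpr ⟨h0, h1⟩] at h2
    exact h2
  constructor
  · obtain ⟨n, hn⟩ := exists_nat_one_div_lt (sub_pos.mpr hb1)
    obtain ⟨j, k, hk, -, h⟩ := Real.exists_int_int_abs_mul_sub_le d (Nat.succ_pos n)
    have hlt : |(k : ℝ) * d - j| < 1 - b := by
      refine lt_of_le_of_lt h (lt_of_le_of_lt ?_ hn)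
      apply one_div_le_one_div_of_le
      · positivity
      · push_cast; linarith
    obtain ⟨e, he⟩ : ∃ e, e = (k : ℝ) * d - j := ⟨_, rfl⟩
    rw [← he, abs_lt] at hlt
    rcases lt_trichotomy e 0 with h0 | h0 | h0
    · have := key k (j - 1) (1 + e) hk (by push_cast; linarith) (by linarith) (by linarith)
      linarith
    · refine ⟨(j : ℚ) / k, ?_⟩
      have : (k : ℝ) ≠ 0 := by exact_mod_cast hk.ne'
      push_cast
      rw [eq_div_iff this]
      linarith
    · obtain ⟨m, hm⟩ : ∃ m : ℤ, m = ⌊b / e⌋ + 1 := ⟨_, rfl⟩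
      have h1 : b / e < m := by rw [hm]; push_cast; exact Int.lt_floor_add_one _
      have h2 : (m : ℝ) ≤ b / e + 1 := by
        rw [hm]; push_cast; linarith [Int.floor_le (b / e)]
      have hm0 : (0 : ℝ) < m := lt_trans (div_pos hb0 h0) h1
      rw [div_lt_iff₀ h0] at h1
      have h3 : (m : ℝ) * e ≤ b + e := by
        calc (m : ℝ) * e ≤ (b / e + 1) * e := by gcongr
          _ = b + e := by field_simp
      have := key (m * k) (m * j) (m * e) (mul_pos (by exact_mod_cast hm0) hk)
        (by push_cast; rw [he]; ring) (by linarith) (by linarith)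
      linarith
  · rintro v ⟨hv, ⟨m, hm⟩, hmin⟩
    have hvR : (0 : ℝ) < v := by exact_mod_cast hv
    have hg : Int.gcd m v = 1 := by
      have hgpos : 0 < Int.gcd m v := Int.gcd_pos_of_ne_zero_right _ (by exact_mod_cast hv.ne')
      obtain ⟨m', hm'⟩ := Int.gcd_dvd_left m (v : ℤ)
      obtain ⟨v', hv'⟩ : Int.gcd m v ∣ v := by exact_mod_cast Int.gcd_dvd_right m (v : ℤ)
      generalize Int.gcd m v = g at *
      have hv'0 : 0 < v' := by
        rcases Nat.eq_zero_or_pos v' with h | h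
        · subst h; omega
        · exact h
      have hle := hmin v' hv'0 ⟨m', by
        have : (g : ℝ) ≠ 0 := by exact_mod_cast hgpos.ne'
        apply mul_left_cancel₀ this
        rw [hv', hm'] at hm
        push_cast at hm
        linarith⟩
      rw [hv'] at hle
      nlinarith
    obtain ⟨a, c, hac⟩ := Int.isCoprime_iff_gcd_eq_one.mpr hg
    have hac' : (a : ℝ) * m + c * v = 1 := by exact_mod_cast hac
    have hj : 0 < -a + v * (|a| + 1) := by
      have : (1 : ℤ) ≤ v := by exact_mod_cast hv
      nlinarith [le_abs_self a, abs_nonneg a]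
    have hv1 : (1 : ℝ) ≤ v := by exact_mod_cast hv
    have hinv : 1 / (v : ℝ) ≤ 1 := by rw [div_le_one hvR]; exact hv1
    have hinv0 : 0 < 1 / (v : ℝ) := by positivity
    have := key (-a + v * (|a| + 1)) (c + (|a| + 1) * m - 1) (1 - 1 / v) hj (by
      have hd : d = m / v := by rw [eq_div_iff hvR.ne']; linarith
      rw [hd]
      push_cast
      field_simp
      linear_combination -hac') (by linarith) (by linarith)
    rw [le_div_iff₀ (by linarith)]
    have h4 : 1 - b ≤ 1 / v := by linarith
    rw [le_div_iff₀ hvR] at h4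
    linarith
end

section
/- Let b be a real number with 0 < b < 1 and set q = ⌊1/(1−b)⌋. Let d be a real number and let (d_j)_{j≥1} be a sequence of nonnegative real numbers with d_j ≤ d for all j ≥ 1, and suppose that the saturation inequality ⌈j·d − b⌉ ≤ j·d_j holds for every positive integer j. Then q!·d is a natural number (in particular d is rational with denominator at most q), and d_j = d for every positive integer j such that j·d ∈ ℤ. -/
/-- The Claim in the proof that a saturated adjoint algebra on `𝔸¹` is finitely
generated: with `q = ⌊1/(1-b)⌋`, the saturation inequality `⌈j·d − b⌉ ≤ j·d_j`
for all `j ≥ 1` forces `q!·d ∈ ℕ`, and `d_j = d` whenever `j·d ∈ ℤ`. -/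
theorem stmt_6 (b : ℝ) (hb0 : 0 < b) (hb1 : b < 1) (q : ℕ)
    (hq : q = ⌊1 / (1 - b)⌋₊) (d : ℝ) (dj : ℕ → ℝ)
    (hnonneg : ∀ j : ℕ, 1 ≤ j → 0 ≤ dj j)
    (hle : ∀ j : ℕ, 1 ≤ j → dj j ≤ d)
    (hsat : ∀ j : ℕ, 1 ≤ j → (⌈(j : ℝ) * d - b⌉ : ℝ) ≤ (j : ℝ) * dj j) :
    (∃ m : ℕ, (q.factorial : ℝ) * d = (m : ℝ)) ∧
    ∀ j : ℕ, 1 ≤ j → (∃ m : ℤ, (j : ℝ) * d = (m : ℝ)) → dj j = d := by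
  have key : ∀ j : ℕ, 1 ≤ j → ∀ z : ℤ, (z : ℝ) + b < j * d → (z : ℝ) + 1 ≤ j * dj j := by
    intro j hj z hz
    have h1 : z < ⌈(j : ℝ) * d - b⌉ := Int.lt_ceil.mpr (by linarith)
    have h2 : ((z + 1 : ℤ) : ℝ) ≤ (⌈(j : ℝ) * d - b⌉ : ℝ) := by exact_mod_cast h1
    push_cast at h2
    linarith [hsat j hj]
  have hmul : ∀ j : ℕ, 1 ≤ j → (j : ℝ) * dj j ≤ j * d := fun j hj =>
    mul_le_mul_of_nonneg_left (hle j hj) (Nat.cast_nonneg j)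
  have hd : 0 ≤ d := (hnonneg 1 le_rfl).trans (hle 1 le_rfl)
  have hb : 0 < 1 - b := by linarith
  constructor
  · have hq1 : 1 ≤ q := by
      rw [hq]
      apply Nat.le_floor
      rw [le_div_iff₀ hb]
      push_cast
      linarith
    have hq2 : 1 / ((q : ℝ) + 1) < 1 - b := by
      have h := Nat.lt_floor_add_one (1 / (1 - b))
      rw [← hq] at h
      rw [div_lt_iff₀ hb] at h
      rw [div_lt_iff₀ (by positivity)]
      linarith
    obtain ⟨k, hk0, hkq, hk⟩ := Real.exists_nat_abs_mul_sub_round_le d hq1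
    generalize round ((k : ℝ) * d) = r at hk
    have hlt := lt_of_le_of_lt hk hq2
    obtain ⟨hl, hu⟩ := abs_lt.mp hlt
    rcases lt_trichotomy ((k : ℝ) * d - r) 0 with h | h | h
    · have h3 := key k hk0 (r - 1) (by push_cast; linarith)
      push_cast at h3
      linarith [hmul k hk0]
    · obtain ⟨c, hc⟩ := Nat.dvd_factorial hk0 hkq
      have hr : (0 : ℝ) ≤ r := by
        have : 0 ≤ (k : ℝ) * d := by positivity
        linarith
      have hr' : 0 ≤ r := by exact_mod_cast hr
      lift r to ℕ using hr'
      refine ⟨c * r, ?_⟩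
      rw [hc]
      push_cast at h ⊢
      linear_combination (c : ℝ) * h
    · set e := (k : ℝ) * d - r with he
      obtain ⟨m, hm1, hm2⟩ : ∃ m : ℕ, (m : ℝ) * e < 1 ∧ 1 ≤ (m + 1 : ℝ) * e := by
        have hc0 : 0 < ⌈1 / e⌉₊ := Nat.ceil_pos.mpr (by positivity)
        obtain ⟨m, hm⟩ := Nat.exists_eq_succ_of_ne_zero hc0.ne'
        refine ⟨m, ?_, ?_⟩
        · rw [← lt_div_iff₀ h]
          exact Nat.lt_ceil.mp (by omega)
        · rw [← div_le_iff₀ h]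
          have := Nat.le_ceil (1 / e)
          rw [hm] at this
          push_cast at this
          exact this
      have hm0 : 1 ≤ m := by
        rcases Nat.eq_zero_or_pos m with h0 | h0
        · subst h0
          norm_num at hm2
          linarith
        · exact h0
      have hmk : 1 ≤ m * k := Nat.mul_pos hm0 hk0
      have hval : ((m * k : ℕ) : ℝ) * d = m * r + m * e := by
        rw [he]
        push_cast
        ring
      have h3 := key (m * k) hmk (m * r) (by rw [hval]; push_cast; linarith)
      have h4 := hmul (m * k) hmk
      rw [hval] at h4
      push_cast at h3 h4
      linarith
  · rintro j hj ⟨m, hm⟩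
    have h3 := key j hj (m - 1) (by push_cast; linarith)
    push_cast at h3
    have hj0 : (0 : ℝ) < j := by exact_mod_cast hj
    apply le_antisymm (hle j hj)
    apply le_of_mul_le_mul_left _ hj0
    linarith
end

section
/- Let k be a field, let k(x) be the field of rational functions in one variable over k, and let T be an indeterminate over k(x). Let b be a real number with 0 < b < 1 and let (d_i)_{i≥1} be a sequence of nonnegative real numbers satisfying: (concavity) (i+j)·d_{i+j} ≥ i·d_i + j·d_j for all i, j ≥ 1; (saturation) ⌈j·d_i − b⌉ ≤ j·d_j for all integers i ≥ j ≥ 1. Consider the graded k-subalgebra R = k[x] ⊕ ⊕_{i≥1} x^{−⌊i·d_i⌋}·k[x]·T^i of k(x)[T]. Then R is a finitely generated k-algebra. -/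
open Polynomial in
/-- The degree `n` piece, as a `k[X]`-submodule of `k(X)`. -/
noncomputable def pieceMod (k : Type*) [Field k] (m : ℕ → ℤ) (n : ℕ) :
    Submodule (Polynomial k) (RatFunc k) :=
  Submodule.span (Polynomial k) {(RatFunc.X : RatFunc k) ^ (-m n)}

theorem mem_pieceMod {k : Type*} [Field k] {m : ℕ → ℤ} {n : ℕ} {f : RatFunc k} :
    f ∈ pieceMod k m n ↔ ∃ g : Polynomial k,
      f = (RatFunc.X : RatFunc k) ^ (-m n) * algebraMap (Polynomial k) (RatFunc k) g := by
  unfold pieceMod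
  rw [Submodule.mem_span_singleton]
  constructor
  · rintro ⟨a, rfl⟩
    exact ⟨a, by rw [Algebra.smul_def, mul_comm]⟩
  · rintro ⟨a, rfl⟩
    exact ⟨a, by rw [Algebra.smul_def, mul_comm]⟩

theorem pieceMod_mul {k : Type*} [Field k] {m : ℕ → ℤ}
    (hm : ∀ i j, m i + m j ≤ m (i + j)) {i j : ℕ} {f g : RatFunc k}
    (hf : f ∈ pieceMod k m i) (hg : g ∈ pieceMod k m j) : f * g ∈ pieceMod k m (i + j) := by
  rw [mem_pieceMod] at *
  obtain ⟨a, rfl⟩ := hf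
  obtain ⟨c, rfl⟩ := hg
  obtain ⟨e, he⟩ := Int.eq_ofNat_of_zero_le (sub_nonneg.2 (hm i j))
  refine ⟨a * c * Polynomial.X ^ e, ?_⟩
  have hX : (RatFunc.X : RatFunc k) ≠ 0 := RatFunc.X_ne_zero
  have h1 : (RatFunc.X : RatFunc k) ^ (-m i) * RatFunc.X ^ (-m j)
      = RatFunc.X ^ (-m (i + j)) * RatFunc.X ^ e := by
    rw [← zpow_natCast, ← zpow_add₀ hX, ← zpow_add₀ hX]
    congr 1
    omega
  rw [map_mul, map_mul, map_pow, RatFunc.algebraMap_X]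
  linear_combination (algebraMap (Polynomial k) (RatFunc k) a *
    algebraMap (Polynomial k) (RatFunc k) c) * h1

/-- The graded algebra. -/
noncomputable def gradedAlg (k : Type*) [Field k] (m : ℕ → ℤ) (h0 : m 0 = 0)
    (hm : ∀ i j, m i + m j ≤ m (i + j)) : Subalgebra k (Polynomial (RatFunc k)) where
  carrier := {P | ∀ i, P.coeff i ∈ pieceMod k m i}
  add_mem' := by
    intro a c ha hc i
    rw [Polynomial.coeff_add]
    exact Submodule.add_mem _ (ha i) (hc i)
  mul_mem' := by
    intro a c ha hc i
    rw [Polynomial.coeff_mul]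
    refine Submodule.sum_mem _ ?_
    rintro ⟨u, v⟩ huv
    rw [Finset.HasAntidiagonal.mem_antidiagonal] at huv
    subst huv
    exact pieceMod_mul hm (ha u) (hc v)
  algebraMap_mem' := by
    intro r i
    rw [Polynomial.algebraMap_apply, Polynomial.coeff_C]
    split_ifs with h
    · subst h
      rw [mem_pieceMod]
      refine ⟨Polynomial.C r, ?_⟩
      rw [h0]
      simp
    · exact Submodule.zero_mem _

theorem gradedAlg_fg (k : Type*) [Field k] (m : ℕ → ℤ) (h0 : m 0 = 0)
    (hm : ∀ i j, m i + m j ≤ m (i + j)) (q : ℕ) (hq : 1 ≤ q) (N : ℕ)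
    (hN : ∀ i, N ≤ i → m (i + q) = m i + m q) : (gradedAlg k m h0 hm).FG := by
  classical
  have hX : (RatFunc.X : RatFunc k) ≠ 0 := RatFunc.X_ne_zero
  let F : ℕ → Polynomial (RatFunc k) := fun i => Polynomial.monomial i (RatFunc.X ^ (-m i))
  refine ⟨insert (Polynomial.C RatFunc.X) ((Finset.range (N + q + 1)).image F), ?_⟩
  set S := Algebra.adjoin k
    ((insert (Polynomial.C RatFunc.X) ((Finset.range (N + q + 1)).image F) : Finset _) :
      Set (Polynomial (RatFunc k))) with hS
  have hXS : (Polynomial.C RatFunc.X : Polynomial (RatFunc k)) ∈ S :=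
    Algebra.subset_adjoin (by simp)
  have hF : ∀ i, F i ∈ S := by
    intro i
    induction i using Nat.strong_induction_on with
    | _ i ih =>
      by_cases hi : i < N + q + 1
      · refine Algebra.subset_adjoin ?_
        rw [Finset.mem_coe, Finset.mem_insert]
        exact Or.inr (Finset.mem_image_of_mem _ (Finset.mem_range.2 hi))
      · have e : i = (i - q) + q := by omega
        have h2 : F i = F (i - q) * F q := by
          have h3 := hN (i - q) (by omega)
          rw [← e] at h3
          simp only [F]
          rw [Polynomial.monomial_mul_monomial, ← zpow_add₀ hX, ← e, h3]
          congr 2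
          ring
        rw [h2]
        exact S.mul_mem (ih _ (by omega)) (ih _ (by omega))
  have hC : ∀ g : Polynomial k,
      Polynomial.C (algebraMap (Polynomial k) (RatFunc k) g) ∈ S := by
    intro g
    induction g using Polynomial.induction_on' with
    | add a c ha hc =>
      rw [map_add, map_add]
      exact S.add_mem ha hc
    | monomial n a =>
      rw [← Polynomial.C_mul_X_pow_eq_monomial, map_mul, map_mul, map_pow, map_pow,
        RatFunc.algebraMap_X]
      refine S.mul_mem ?_ (S.pow_mem hXS n)
      have := S.algebraMap_mem a
      rw [Polynomial.algebraMap_apply] at this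
      simpa using this
  apply le_antisymm
  · rw [hS, Algebra.adjoin_le_iff]
    intro P hP
    rw [Finset.mem_coe, Finset.mem_insert, Finset.mem_image] at hP
    intro i
    rw [mem_pieceMod]
    rcases hP with rfl | ⟨n, -, rfl⟩
    · rw [Polynomial.coeff_C]
      split_ifs with h
      · subst h
        exact ⟨Polynomial.X, by simp [h0]⟩
      · exact ⟨0, by simp⟩
    · simp only [F]
      rw [Polynomial.coeff_monomial]
      split_ifs with h
      · subst h
        exact ⟨1, by simp⟩
      · exact ⟨0, by simp⟩
  · intro P hP
    rw [P.as_sum_range]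
    refine S.sum_mem ?_
    intro i _
    obtain ⟨g, hg⟩ := mem_pieceMod.1 (hP i)
    have : Polynomial.monomial i (P.coeff i)
        = F i * Polynomial.C (algebraMap (Polynomial k) (RatFunc k) g) := by
      simp only [F]
      rw [hg, Polynomial.monomial_mul_C]
    rw [this]
    exact S.mul_mem (hF i) (hC g)

theorem eventually_periodic (m : ℕ → ℤ) (hm : ∀ i j, m i + m j ≤ m (i + j)) (q : ℕ)
    (hle : ∀ i : ℕ, q * m i ≤ i * m q) (hq : 1 ≤ q) :
    ∃ N : ℕ, ∀ i, N ≤ i → m (i + q) = m i + m q := by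
  let c : ℕ → ℕ := fun i => (i * m q - q * m i).toNat
  have hc : ∀ i, (c i : ℤ) = i * m q - q * m i := fun i =>
    Int.toNat_of_nonneg (sub_nonneg.2 (hle i))
  have hq' : (0 : ℤ) < q := by exact_mod_cast hq
  have hcle : ∀ i, c (i + q) ≤ c i := by
    intro i
    zify
    rw [hc, hc]
    push_cast
    nlinarith [hm i q]
  let s : ℕ → ℕ := fun n => ∑ r ∈ Finset.range q, c (n + r)
  have hs : ∀ n, s (n + 1) + c n = s n + c (n + q) := by
    intro n
    simp only [s]
    rw [← Finset.sum_range_succ (fun r => c (n + r)), Finset.sum_range_succ' (fun r => c (n + r))]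
    simp only [add_zero]
    congr 1
    refine Finset.sum_congr rfl fun r _ => ?_
    congr 1
    omega
  have hanti : Antitone s := antitone_nat_of_succ_le fun n => by
    have := hs n
    have := hcle n
    omega
  obtain ⟨N, hN⟩ : ∃ N, ∀ n, N ≤ n → s N = s n := by
    have hne : (Set.range s).Nonempty := ⟨s 0, 0, rfl⟩
    obtain ⟨N, hN⟩ := Nat.sInf_mem hne
    refine ⟨N, fun n hn => le_antisymm ?_ (hanti hn)⟩
    rw [hN]
    exact Nat.sInf_le ⟨n, rfl⟩
  refine ⟨N, fun i hi => ?_⟩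
  have h1 := hs i
  have h2 := hN i hi
  have h3 := hN (i + 1) (by omega)
  have h4 : c (i + q) = c i := by omega
  zify at h4
  rw [hc, hc] at h4
  push_cast at h4
  have : (q : ℤ) * (m (i + q) - (m i + m q)) = 0 := by linarith
  rcases mul_eq_zero.1 this with h | h <;> omega

theorem exists_int_multiple (b D : ℝ) (hb0 : 0 < b) (hb1 : b < 1)
    (h : ∀ j : ℕ, 1 ≤ j → (⌈(j : ℝ) * D - b⌉ : ℝ) ≤ j * D) :
    ∃ q : ℕ, 1 ≤ q ∧ ∃ p : ℤ, (q : ℝ) * D = p := by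
  obtain ⟨n, hn⟩ := exists_nat_one_div_lt (sub_pos.2 hb1)
  obtain ⟨j, hj0, -, hj⟩ := Real.exists_nat_abs_mul_sub_round_le D (n := n + 1) (by omega)
  refine ⟨j, hj0, round ((j : ℝ) * D), ?_⟩
  set p := round ((j : ℝ) * D)
  have hlt : |(j : ℝ) * D - p| < 1 - b := by
    refine lt_of_le_of_lt hj (lt_of_le_of_lt ?_ hn)
    push_cast
    apply one_div_le_one_div_of_le <;> linarith [(Nat.cast_nonneg n : (0 : ℝ) ≤ n)]
  rw [abs_lt] at hlt
  rcases lt_trichotomy ((j : ℝ) * D) p with hneg | heq | hpos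
  · exfalso
    have h1 : p ≤ ⌈(j : ℝ) * D - b⌉ := by
      rw [Int.le_ceil_iff]
      linarith
    have h2 : (p : ℝ) ≤ ⌈(j : ℝ) * D - b⌉ := by exact_mod_cast h1
    linarith [h j hj0]
  · exact heq
  · exfalso
    set e := (j : ℝ) * D - p with he
    have he0 : 0 < e := by linarith
    have hc1 := Nat.le_ceil (1 / e)
    have hc2 := Nat.ceil_lt_add_one (one_div_pos.2 he0).le
    have hgt : 1 < 1 / e := by
      rw [lt_div_iff₀ he0]; linarith
    obtain ⟨t, ht⟩ : ∃ t, ⌈1 / e⌉₊ = t + 1 :=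
      Nat.exists_eq_succ_of_ne_zero (by
        intro h0
        rw [h0] at hc1
        norm_num at hc1
        have := inv_pos.2 he0
        linarith)
    rw [ht] at hc1 hc2
    push_cast at hc1 hc2
    have ht1 : (t : ℝ) * e < 1 := by
      have : (t : ℝ) < 1 / e := by linarith
      rwa [lt_div_iff₀ he0] at this
    have ht2 : b < t * e := by
      rw [div_le_iff₀ he0] at hc1
      linarith
    have ht0 : 1 ≤ t := by
      rcases Nat.eq_zero_or_pos t with h0 | h0
      · rw [h0] at ht2
        norm_num at ht2
        linarith
      · exact h0
    have h3 := h (t * j) (Nat.mul_pos ht0 hj0)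
    have hval : ((t * j : ℕ) : ℝ) * D = t * p + t * e := by
      rw [he]; push_cast; ring
    rw [hval] at h3
    have h1 : (t : ℤ) * p + 1 ≤ ⌈(t : ℝ) * p + t * e - b⌉ := by
      rw [Int.le_ceil_iff]
      push_cast
      linarith
    have h2 : (t : ℝ) * p + 1 ≤ ⌈(t : ℝ) * p + t * e - b⌉ := by exact_mod_cast h1
    linarith

/-- A saturated adjoint algebra on `𝔸¹` supported at the single point `{x = 0}`
is finitely generated: the graded subalgebra
`R = k[x] ⊕ ⊕_{i≥1} x^{−⌊i·d_i⌋}·k[x]·T^i` of `k(x)[T]` is a finitely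
generated `k`-algebra. -/
theorem stmt_7 (k : Type*) [Field k] (b : ℝ) (hb0 : 0 < b) (hb1 : b < 1)
    (d : ℕ → ℝ) (hnn : ∀ i : ℕ, 1 ≤ i → 0 ≤ d i)
    (hconc : ∀ i j : ℕ, 1 ≤ i → 1 ≤ j →
      ((i + j : ℕ) : ℝ) * d (i + j) ≥ (i : ℝ) * d i + (j : ℝ) * d j)
    (hsat : ∀ i j : ℕ, 1 ≤ j → j ≤ i →
      (⌈(j : ℝ) * d i - b⌉ : ℝ) ≤ (j : ℝ) * d j) :
    ∃ R : Subalgebra k (Polynomial (RatFunc k)),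
      (R : Set (Polynomial (RatFunc k))) =
        {P : Polynomial (RatFunc k) | ∀ i : ℕ, ∃ g : Polynomial k,
          P.coeff i = (RatFunc.X : RatFunc k) ^ (-⌊(i : ℝ) * d i⌋) *
            algebraMap (Polynomial k) (RatFunc k) g} ∧
      R.FG := by
  let m : ℕ → ℤ := fun i => ⌊(i : ℝ) * d i⌋
  have h0 : m 0 = 0 := by simp [m]
  have hm : ∀ i j, m i + m j ≤ m (i + j) := by
    intro i j
    rcases Nat.eq_zero_or_pos i with rfl | hi
    · simp [h0]
    rcases Nat.eq_zero_or_pos j with rfl | hj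
    · simp [h0]
    simp only [m]
    rw [Int.le_floor]
    push_cast
    have h1 := hconc i j hi hj
    push_cast at h1
    linarith [Int.floor_le ((i : ℝ) * d i), Int.floor_le ((j : ℝ) * d j)]
  -- multiples
  have hmul : ∀ i, 1 ≤ i → ∀ t : ℕ, d i ≤ d ((t + 1) * i) := by
    intro i hi t
    have key : ((t + 1 : ℕ) : ℝ) * (i * d i) ≤ (((t + 1) * i : ℕ) : ℝ) * d ((t + 1) * i) := by
      induction t with
      | zero => simp
      | succ t ih =>
        have h1 := hconc ((t + 1) * i) i (Nat.mul_pos (by omega) hi) hi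
        have e : (t + 1 + 1) * i = (t + 1) * i + i := by ring
        rw [e]
        push_cast at *
        linarith
    have hpos : (0 : ℝ) < (((t + 1) * i : ℕ) : ℝ) := by
      exact_mod_cast Nat.mul_pos (by omega) hi
    have : (((t + 1) * i : ℕ) : ℝ) * d i ≤ (((t + 1) * i : ℕ) : ℝ) * d ((t + 1) * i) := by
      refine le_trans (le_of_eq ?_) key
      push_cast; ring
    exact le_of_mul_le_mul_left this hpos
  let A : Set ℝ := d '' Set.Ici 1
  have hbdd : BddAbove A := by
    refine ⟨d 1 + b, ?_⟩
    rintro _ ⟨i, hi, rfl⟩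
    have h1 := hsat i 1 le_rfl hi
    have h2 := Int.le_ceil (((1 : ℕ) : ℝ) * d i - b)
    push_cast at *
    linarith
  have hne : A.Nonempty := ⟨d 1, 1, by simp, rfl⟩
  set D := sSup A with hD
  have hdD : ∀ i, 1 ≤ i → d i ≤ D := fun i hi => le_csSup hbdd ⟨i, hi, rfl⟩
  have hlim : ∀ j : ℕ, 1 ≤ j → (⌈(j : ℝ) * D - b⌉ : ℝ) ≤ j * d j := by
    intro j hj
    have hj' : (0 : ℝ) < j := by exact_mod_cast hj
    set n := ⌈(j : ℝ) * D - b⌉ with hn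
    have h1 : (n : ℝ) - 1 < j * D - b := by
      have := Int.ceil_lt_add_one ((j : ℝ) * D - b)
      linarith
    have h2 : ((n : ℝ) - 1 + b) / j < D := by
      rw [div_lt_iff₀ hj']; linarith
    obtain ⟨_, ⟨i, hi, rfl⟩, hlt⟩ := exists_lt_of_lt_csSup hne h2
    have h3 := hmul i hi j
    have hi1 : 1 ≤ i := hi
    have h4 := hsat ((j + 1) * i) j hj (by nlinarith)
    refine le_trans ?_ h4
    rw [div_lt_iff₀ hj'] at hlt
    have h5 : n ≤ ⌈(j : ℝ) * d ((j + 1) * i) - b⌉ := by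
      rw [Int.le_ceil_iff]
      nlinarith
    exact_mod_cast h5
  have hle : ∀ j : ℕ, (j : ℝ) * d j ≤ j * D := by
    intro j
    rcases Nat.eq_zero_or_pos j with rfl | hj
    · simp
    exact mul_le_mul_of_nonneg_left (hdD j hj) (Nat.cast_nonneg j)
  obtain ⟨q, hq, p, hp⟩ := exists_int_multiple b D hb0 hb1
    (fun j hj => (hlim j hj).trans (hle j))
  have hmq : (p : ℤ) ≤ m q := by
    have h1 := hlim q hq
    rw [hp] at h1
    simp only [m]
    rw [Int.le_floor]
    refine le_trans ?_ h1
    have : p ≤ ⌈(p : ℝ) - b⌉ := by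
      rw [Int.le_ceil_iff]; linarith
    exact_mod_cast this
  have hqm : ∀ i : ℕ, q * m i ≤ i * m q := by
    intro i
    have h1 : (m i : ℝ) ≤ i * D := (Int.floor_le _).trans (hle i)
    have h2 : (q * m i : ℝ) ≤ i * p := by
      rw [← hp]
      have hq0 : (0 : ℝ) ≤ q := Nat.cast_nonneg q
      nlinarith
    have h3 : (q * m i : ℤ) ≤ i * p := by exact_mod_cast h2
    exact h3.trans (mul_le_mul_of_nonneg_left hmq (by positivity))
  obtain ⟨N, hN⟩ := eventually_periodic m hm q hqm hq
  refine ⟨gradedAlg k m h0 hm, ?_, gradedAlg_fg k m h0 hm q hq N hN⟩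
  ext P
  exact forall_congr' fun i => mem_pieceMod
end

section
/- Let R = ⊕_{n≥0} R_n be a commutative ℕ-graded ring which is an integral domain, and suppose that its degree-zero part R₀ is Noetherian. Fix a positive integer I and let R^{(I)} = ⊕_{n≥0} R_{nI} be the I-th truncation (the I-th Veronese subalgebra, with its induced grading). Then R is a finitely generated R₀-algebra if and only if R^{(I)} is a finitely generated R₀-algebra. -/
/-- `a` is supported in degrees congruent to `r` modulo `I`. -/
def SuppMod {R : Type*} [CommRing R] (𝒜 : ℕ → AddSubgroup R) [GradedRing 𝒜] (I : ℕ)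
    (r : ZMod I) (a : R) : Prop :=
  ∀ n : ℕ, (n : ZMod I) ≠ r → (DirectSum.decompose 𝒜 a n : R) = 0

section
variable {R : Type*} [CommRing R] {𝒜 : ℕ → AddSubgroup R} [GradedRing 𝒜] {I : ℕ}

theorem SuppMod.zero (r : ZMod I) : SuppMod 𝒜 I r 0 := by
  intro n _; simp

theorem SuppMod.add {r : ZMod I} {a b : R} (ha : SuppMod 𝒜 I r a) (hb : SuppMod 𝒜 I r b) :
    SuppMod 𝒜 I r (a + b) := by
  intro n hn; simp [DirectSum.decompose_add, ha n hn, hb n hn]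

theorem SuppMod.of_mem {n : ℕ} {a : R} (ha : a ∈ 𝒜 n) : SuppMod 𝒜 I (n : ZMod I) a := by
  intro m hm
  exact DirectSum.decompose_of_mem_ne 𝒜 ha (fun h => hm (by rw [h]))

theorem SuppMod.mul {r s : ZMod I} {a b : R} (ha : SuppMod 𝒜 I r a) (hb : SuppMod 𝒜 I s b) :
    SuppMod 𝒜 I (r + s) (a * b) := by
  classical
  intro n hn
  rw [DirectSum.decompose_mul, DirectSum.coe_mul_apply]
  refine Finset.sum_eq_zero ?_
  rintro ⟨i, j⟩ hij
  have hij' : i + j = n := (Finset.mem_filter.mp hij).2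
  by_cases hi : (i : ZMod I) = r
  · by_cases hj : (j : ZMod I) = s
    · exact absurd (by rw [← hij', ← hi, ← hj]; push_cast; rfl) hn
    · simp [hb j hj]
  · simp [ha i hi]

theorem SuppMod.one : SuppMod 𝒜 I 0 (1 : R) := by
  simpa using SuppMod.of_mem (I := I) (SetLike.GradedOne.one_mem (A := 𝒜))

theorem SuppMod.pow {r : ZMod I} {a : R} (ha : SuppMod 𝒜 I r a) (k : ℕ) :
    SuppMod 𝒜 I (k * r) (a ^ k) := by
  induction k with
  | zero => simpa using SuppMod.one
  | succ k ih =>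
    have := ih.mul ha
    rw [pow_succ]
    convert this using 1
    push_cast; ring

end

/-- The truncation as a subalgebra. -/
def truncAlg {R : Type*} [CommRing R] (𝒜 : ℕ → AddSubgroup R) [GradedRing 𝒜] (I : ℕ) :
    Subalgebra (SetLike.GradeZero.subring 𝒜) R where
  carrier := {a | SuppMod 𝒜 I 0 a}
  mul_mem' ha hb := by simpa using SuppMod.mul ha hb
  add_mem' ha hb := SuppMod.add ha hb
  algebraMap_mem' r := by
    have h : (r : R) ∈ 𝒜 0 := r.2
    have h2 := SuppMod.of_mem (I := I) h
    rw [Nat.cast_zero] at h2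
    exact h2

/-- The part of `R` in degrees congruent to `r`, as a module over the truncation. -/
def truncMod {R : Type*} [CommRing R] (𝒜 : ℕ → AddSubgroup R) [GradedRing 𝒜] (I : ℕ)
    (r : ZMod I) : Submodule (truncAlg 𝒜 I) R where
  carrier := {a | SuppMod 𝒜 I r a}
  add_mem' ha hb := SuppMod.add ha hb
  zero_mem' := SuppMod.zero r
  smul_mem' c x hx := by
    have h : SuppMod 𝒜 I 0 (c : R) := c.2
    have := h.mul hx
    rw [zero_add] at this
    exact this

theorem truncMod_fg {R : Type*} [CommRing R] [IsDomain R] (𝒜 : ℕ → AddSubgroup R)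
    [GradedRing 𝒜] (I : ℕ) (hI : 0 < I) [IsNoetherianRing (truncAlg 𝒜 I)] (r : ZMod I) :
    (truncMod 𝒜 I r).FG := by
  by_cases h : truncMod 𝒜 I r = ⊥
  · rw [h]; exact Submodule.fg_bot
  obtain ⟨x, hx, hx0⟩ := Submodule.exists_mem_ne_zero_of_ne_bot h
  have key : ∀ y : truncMod 𝒜 I r, x ^ (I - 1) * (y : R) ∈ truncAlg 𝒜 I := by
    intro y
    have h1 := (SuppMod.pow (show SuppMod 𝒜 I r x from hx) (I - 1)).mul
      (show SuppMod 𝒜 I r (y : R) from y.2)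
    have h2 : ((I - 1 : ℕ) : ZMod I) * r + r = 0 := by
      rw [Nat.cast_sub hI]; simp
    rw [h2] at h1
    exact h1
  let f : truncMod 𝒜 I r →ₗ[truncAlg 𝒜 I] truncAlg 𝒜 I :=
    { toFun := fun y => ⟨x ^ (I - 1) * (y : R), key y⟩
      map_add' := fun a b => Subtype.ext (mul_add _ _ _)
      map_smul' := fun c a => Subtype.ext (by
        change x ^ (I - 1) * ((c : R) * (a : R)) = (c : R) * (x ^ (I - 1) * (a : R))
        ring) }
  have hf : Function.Injective f := by
    intro a b hab
    have : x ^ (I - 1) * (a : R) = x ^ (I - 1) * (b : R) := congrArg Subtype.val hab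
    exact Subtype.ext (mul_left_cancel₀ (pow_ne_zero _ hx0) this)
  have : IsNoetherian (truncAlg 𝒜 I) (truncMod 𝒜 I r) := isNoetherian_of_injective f hf
  exact Module.Finite.iff_fg.mp inferInstance

/-- Truncation lemma: an ℕ-graded commutative domain `R` with Noetherian
degree-zero part `R₀` is a finitely generated `R₀`-algebra if and only if its
`I`-th truncation (Veronese subalgebra) `R^{(I)} = ⊕_{n≥0} R_{nI}` is. -/
theorem stmt_8 (R : Type*) [CommRing R] [IsDomain R] (𝒜 : ℕ → AddSubgroup R)
    [GradedRing 𝒜] (hNoeth : IsNoetherianRing (SetLike.GradeZero.subring 𝒜))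
    (I : ℕ) (hI : 0 < I) :
    ∃ B : Subalgebra (SetLike.GradeZero.subring 𝒜) R,
      (B : Set R) = {a : R | ∀ n : ℕ, ¬ I ∣ n → (DirectSum.decompose 𝒜 a n : R) = 0} ∧
      (Algebra.FiniteType (SetLike.GradeZero.subring 𝒜) R ↔ B.FG) := by
  classical
  refine ⟨truncAlg 𝒜 I, ?_, ?_, ?_⟩
  · ext a
    change (∀ n : ℕ, (n : ZMod I) ≠ 0 → _) ↔ _
    simp only [ne_eq, ZMod.natCast_eq_zero_iff, Set.mem_ofPred_eq]
  · intro hft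
    have hint : Algebra.IsIntegral (truncAlg 𝒜 I) R := by
      refine ⟨fun a => ?_⟩
      rw [← DirectSum.sum_support_decompose 𝒜 a]
      refine IsIntegral.sum _ fun n _ => ?_
      refine IsIntegral.of_pow hI ?_
      have h := (SuppMod.of_mem (I := I) (DirectSum.decompose 𝒜 a n).2).pow I
      rw [CharP.cast_eq_zero, zero_mul] at h
      exact isIntegral_algebraMap (x := (⟨_, h⟩ : truncAlg 𝒜 I))
    have hft2 : Algebra.FiniteType (truncAlg 𝒜 I) R :=
      Algebra.FiniteType.of_restrictScalars_finiteType (SetLike.GradeZero.subring 𝒜) _ _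
    have hfin : Module.Finite (truncAlg 𝒜 I) R := Algebra.IsIntegral.finite
    have := fg_of_fg_of_fg (SetLike.GradeZero.subring 𝒜) (truncAlg 𝒜 I) R hft.1 hfin.1
      Subtype.val_injective
    exact (Subalgebra.fg_top _).mp this
  · intro hB
    have hB' : Algebra.FiniteType (SetLike.GradeZero.subring 𝒜) (truncAlg 𝒜 I) :=
      ⟨(Subalgebra.fg_top _).mpr hB⟩
    have hN : IsNoetherianRing (truncAlg 𝒜 I) :=
      Algebra.FiniteType.isNoetherianRing (SetLike.GradeZero.subring 𝒜) _
    have : NeZero I := ⟨hI.ne'⟩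
    have htop : (⨆ r : ZMod I, truncMod 𝒜 I r) = ⊤ := by
      refine eq_top_iff.mpr fun a _ => ?_
      rw [← DirectSum.sum_support_decompose 𝒜 a]
      refine Submodule.sum_mem _ fun n _ => ?_
      exact Submodule.mem_iSup_of_mem (n : ZMod I)
        (SuppMod.of_mem (I := I) (DirectSum.decompose 𝒜 a n).2)
    have hfin : Module.Finite (truncAlg 𝒜 I) R :=
      ⟨htop ▸ Submodule.fg_iSup _ fun r => truncMod_fg 𝒜 I hI r⟩
    exact Algebra.FiniteType.trans hB' inferInstance
end

section
/- Let b ≥ 0 be a real number and let (g_m)_{m≥1} be a sequence of nonnegative real numbers such that (m+n)·g_{m+n} ≤ m·g_m + n·g_n for all m, n ≥ 1 (i.e. the sequence (m·g_m) is subadditive). Define b_m = b − min(b, g_m) for each m ≥ 1. Then there exists a positive integer k such that the sequence (b_{km})_{m≥1} is concave, in the sense that (i+j)·b_{k(i+j)} ≥ i·b_{ki} + j·b_{kj} for all i, j ≥ 1. -/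
/-- Numerical content of Step 4 of the theorem on boundary b-divisors: if
`(m·g_m)` is subadditive and `b_m = b − min(b, g_m)`, then the sequence
`(b_{km})` is concave for a suitable positive integer `k`. -/
theorem stmt_9 (b : ℝ) (hb : 0 ≤ b) (g : ℕ → ℝ)
    (hg : ∀ m : ℕ, 1 ≤ m → 0 ≤ g m)
    (hsub : ∀ m n : ℕ, 1 ≤ m → 1 ≤ n →
      ((m + n : ℕ) : ℝ) * g (m + n) ≤ (m : ℝ) * g m + (n : ℝ) * g n)
    (bseq : ℕ → ℝ) (hbseq : ∀ m : ℕ, bseq m = b - min b (g m)) :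
    ∃ k : ℕ, 0 < k ∧ ∀ i j : ℕ, 1 ≤ i → 1 ≤ j →
      ((i + j : ℕ) : ℝ) * bseq (k * (i + j)) ≥
        (i : ℝ) * bseq (k * i) + (j : ℝ) * bseq (k * j) := by
  by_cases h : ∃ k : ℕ, 1 ≤ k ∧ g k ≤ b
  · obtain ⟨k, hk, hkb⟩ := h
    have hk0 : (0 : ℝ) < k := by exact_mod_cast hk
    have key : ∀ i j : ℕ, 1 ≤ i → 1 ≤ j →
        ((i + j : ℕ) : ℝ) * g (k * (i + j)) ≤ (i : ℝ) * g (k * i) + (j : ℝ) * g (k * j) := by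
      intro i j hi hj
      have h1 := hsub (k * i) (k * j) (Nat.mul_pos hk hi) (Nat.mul_pos hk hj)
      rw [← Nat.mul_add] at h1
      push_cast at h1 ⊢
      refine le_of_mul_le_mul_left ?_ hk0
      linarith
    have hle : ∀ i : ℕ, 1 ≤ i → g (k * i) ≤ b := by
      intro i hi
      induction i, hi using Nat.le_induction with
      | base => simpa using hkb
      | succ n hn ih =>
        have h1 := key n 1 hn le_rfl
        have hn0 : (0 : ℝ) < n := by exact_mod_cast hn
        push_cast at h1
        rw [mul_one] at h1
        have h2 := mul_le_mul_of_nonneg_left ih hn0.le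
        refine le_of_mul_le_mul_left (?_ : ((n : ℝ) + 1) * _ ≤ ((n : ℝ) + 1) * b) (by linarith)
        linarith
    refine ⟨k, hk, fun i j hi hj => ?_⟩
    have h1 := key i j hi hj
    rw [hbseq, hbseq, hbseq, min_eq_right (hle i hi), min_eq_right (hle j hj),
      min_eq_right (hle (i + j) (by omega))]
    push_cast at h1 ⊢
    linarith
  · push Not at h
    have hz : ∀ m : ℕ, 1 ≤ m → bseq m = 0 := by
      intro m hm
      rw [hbseq, min_eq_left (h m hm).le, sub_self]
    refine ⟨1, one_pos, fun i j hi hj => ?_⟩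
    rw [hz _ (by omega), hz _ (by omega), hz _ (by omega)]
    simp
end
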